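/- Let n ≥ 1 and m ≥ 2 be integers. There is no function f : ℝ → ℝ such that (i) the radial function x ↦ f(‖x‖) is smooth on ℝ^m, (ii) the function x ↦ exp(−2 f(‖x‖)) is integrable on ℝ^m (with Lebesgue measure), and (iii) for every r > 0 both differential inequalities hold: (n+m−1)·f''(r) + (m−1)·f'(r)/r > 0 and f''(r) + (2m+n−3)·f'(r)/r − (m+n−2)·(f'(r))² > 0. -/

import Mathlib

open MeasureTheory

lemma aux_pos (h1 : ℝ → ℝ) (A B : ℝ) (hA : 0 < A) (hB : 0 < B) (hc : Continuous h1)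
    (hd : Differentiable ℝ h1)
    (h : ∀ r : ℝ, 0 < r → 0 < A * deriv h1 r + B * h1 r / r) :
    ∀ r : ℝ, 0 < r → 0 < h1 r := by
  have hq : 0 < B / A := div_pos hB hA
  have hmono : StrictMonoOn (fun r : ℝ => r ^ (B / A) * h1 r) (Set.Ici 0) := by
    apply strictMonoOn_of_deriv_pos (convex_Ici 0)
    · exact ((Real.continuous_rpow_const hq.le).mul hc).continuousOn
    · intro r hr
      rw [interior_Ici] at hr
      have hr : 0 < r := hr
      have hD : HasDerivAt (fun r : ℝ => r ^ (B / A) * h1 r)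
          ((B / A) * r ^ (B / A - 1) * h1 r + r ^ (B / A) * deriv h1 r) r :=
        (Real.hasDerivAt_rpow_const (Or.inl hr.ne')).mul (hd r).hasDerivAt
      rw [hD.deriv, Real.rpow_sub_one hr.ne']
      have : (B / A) * (r ^ (B / A) / r) * h1 r + r ^ (B / A) * deriv h1 r
          = r ^ (B / A) / A * (A * deriv h1 r + B * h1 r / r) := by
        field_simp
        ring
      rw [this]
      have := Real.rpow_pos_of_pos hr (B / A)
      exact mul_pos (by positivity) (h r hr)
  intro r hr
  have := hmono (Set.mem_Ici.2 le_rfl) (Set.mem_Ici.2 hr.le) hr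
  simp only [Real.zero_rpow hq.ne', zero_mul] at this
  exact (pos_iff_pos_of_mul_pos this).1 (Real.rpow_pos_of_pos hr _)

lemma aux_bound (u : ℝ → ℝ) (p : ℕ) (hp : 1 ≤ p) (c : ℝ) (hc : 0 < c)
    (hd : Differentiable ℝ u) (hpos : ∀ r : ℝ, 0 < r → 0 < u r)
    (h : ∀ r : ℝ, 0 < r → 0 < deriv u r + ((p : ℝ) + 1) * u r / r - c * u r ^ 2) :
    ∀ r : ℝ, 0 < r → u r ≤ p / c / r := by
  have hp0 : (0 : ℝ) < p := by exact_mod_cast hp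
  set g : ℝ → ℝ := fun r => (r ^ (p + 1) * u r)⁻¹ - c / p * (r ^ p)⁻¹ with hg
  have hD : ∀ r : ℝ, 0 < r → HasDerivAt g
      (-(((p + 1 : ℕ) : ℝ) * r ^ p * u r + r ^ (p + 1) * deriv u r) / (r ^ (p + 1) * u r) ^ 2
        - c / p * (-((p : ℝ) * r ^ (p - 1)) / (r ^ p) ^ 2)) r := by
    intro r hr
    have h1 : HasDerivAt (fun r : ℝ => r ^ (p + 1) * u r)
        (((p + 1 : ℕ) : ℝ) * r ^ p * u r + r ^ (p + 1) * deriv u r) r := by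
      exact (hasDerivAt_pow (p + 1) r).mul (hd r).hasDerivAt
    have hu := hpos r hr
    exact (h1.fun_inv (by positivity)).sub
      (((hasDerivAt_pow p r).fun_inv (by positivity)).const_mul (c / p))
  have hanti : StrictAntiOn g (Set.Ioi 0) := by
    apply strictAntiOn_of_deriv_neg (convex_Ioi 0)
    · intro r hr
      exact (hD r hr).continuousAt.continuousWithinAt
    · intro r hr
      rw [interior_Ioi] at hr
      have hr : 0 < r := hr
      rw [(hD r hr).deriv]
      have hu := hpos r hr
      obtain ⟨q, rfl⟩ : ∃ q, p = q + 1 := ⟨p - 1, by omega⟩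
      have hh := h r hr
      have e : (-(((q + 1 + 1 : ℕ) : ℝ) * r ^ (q + 1) * u r + r ^ (q + 1 + 1) * deriv u r)
          / (r ^ (q + 1 + 1) * u r) ^ 2
        - c / (q + 1 : ℕ) * (-(((q + 1 : ℕ) : ℝ) * r ^ (q + 1 - 1)) / (r ^ (q + 1)) ^ 2))
        = - ((deriv u r + (((q + 1 : ℕ) : ℝ) + 1) * u r / r - c * u r ^ 2)
          / (r ^ (q + 2) * u r ^ 2)) := by
        rw [Nat.add_sub_cancel]
        push_cast at hp0 ⊢
        field_simp
        ring
      rw [e]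
      exact neg_neg_of_pos (by positivity)
  have hlim : Filter.Tendsto (fun R : ℝ => - (c / p * (R ^ p)⁻¹)) Filter.atTop (nhds 0) := by
    have := ((Filter.tendsto_pow_atTop (α := ℝ) (n := p) (by omega)).inv_tendsto_atTop).const_mul
      (c / p)
    simpa using this.neg
  intro r hr
  have hgr : 0 ≤ g r := by
    refine le_of_tendsto hlim ?_
    filter_upwards [Filter.eventually_gt_atTop r] with R hR
    have hR0 : 0 < R := hr.trans hR
    have h1 := hanti (Set.mem_Ioi.2 hr) (Set.mem_Ioi.2 hR0) hR
    have hu := hpos R hR0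
    have h2 : 0 < (R ^ (p + 1) * u R)⁻¹ := by positivity
    simp only [hg] at h1 ⊢
    linarith
  have hu := hpos r hr
  have h3 : c / p * (r ^ p)⁻¹ ≤ (r ^ (p + 1) * u r)⁻¹ := by
    simp only [hg] at hgr; linarith
  have h4 := mul_le_mul_of_nonneg_left h3
    (show 0 ≤ r ^ (p + 1) * u r * (p / c / r) by positivity)
  have e1 : r ^ (p + 1) * u r * (p / c / r) * (c / p * (r ^ p)⁻¹) = u r := by
    field_simp
    try ring
  have e2 : r ^ (p + 1) * u r * (p / c / r) * (r ^ (p + 1) * u r)⁻¹ = p / c / r := by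
    field_simp
  rwa [e1, e2] at h4

/-- Analytic core of Theorem 2: for integers `n ≥ 1`, `m ≥ 2`, there is no `f : ℝ → ℝ`
such that `x ↦ f ‖x‖` is smooth on `ℝ^m`, `x ↦ exp (-2 f ‖x‖)` is integrable on `ℝ^m`,
and for every `r > 0` both differential inequalities
`(n+m-1) f'' r + (m-1) f' r / r > 0` and
`f'' r + (2m+n-3) f' r / r - (m+n-2) (f' r)^2 > 0` hold. -/
theorem no_radial_conformal_factor (n m : ℕ) (hn : 1 ≤ n) (hm : 2 ≤ m) :
    ¬ ∃ f : ℝ → ℝ,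
      ContDiff ℝ (⊤ : ℕ∞) (fun x : EuclideanSpace ℝ (Fin m) => f ‖x‖) ∧
      Integrable (fun x : EuclideanSpace ℝ (Fin m) => Real.exp (-2 * f ‖x‖)) ∧
      ∀ r : ℝ, 0 < r →
        0 < ((n : ℝ) + m - 1) * deriv (deriv f) r + ((m : ℝ) - 1) * deriv f r / r ∧
        0 < deriv (deriv f) r + (2 * (m : ℝ) + n - 3) * deriv f r / r
            - ((m : ℝ) + n - 2) * (deriv f r) ^ 2 := by
  rintro ⟨f, hs, hint, hineq⟩
  have hnR : (1 : ℝ) ≤ n := by exact_mod_cast hn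
  have hmR : (2 : ℝ) ≤ m := by exact_mod_cast hm
  have : NeZero m := ⟨by omega⟩
  set e : EuclideanSpace ℝ (Fin m) := EuclideanSpace.single 0 1 with he
  have hen : ‖e‖ = 1 := by simp [he]
  set h : ℝ → ℝ := fun t => f |t| with hh
  have hsm : ContDiff ℝ (⊤ : ℕ∞) h := by
    have : h = (fun x : EuclideanSpace ℝ (Fin m) => f ‖x‖) ∘ (fun t : ℝ => t • e) := by
      funext t
      simp [hh, norm_smul, hen]
    rw [this]
    exact hs.comp (contDiff_id.smul contDiff_const)
  have hd0 : Differentiable ℝ h := hsm.differentiable (by simp)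
  have hsm1 : ContDiff ℝ (⊤ : ℕ∞) (deriv h) := (contDiff_infty_iff_deriv.1 hsm).2
  have hd1 : Differentiable ℝ (deriv h) := hsm1.differentiable (by simp)
  have heq : ∀ r : ℝ, 0 < r → f =ᶠ[nhds r] h := by
    intro r hr
    filter_upwards [lt_mem_nhds hr] with t ht
    simp [hh, abs_of_pos ht]
  have hineq' : ∀ r : ℝ, 0 < r →
        0 < ((n : ℝ) + m - 1) * deriv (deriv h) r + ((m : ℝ) - 1) * deriv h r / r ∧
        0 < deriv (deriv h) r + (2 * (m : ℝ) + n - 3) * deriv h r / r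
            - ((m : ℝ) + n - 2) * (deriv h r) ^ 2 := by
    intro r hr
    have := hineq r hr
    rwa [(heq r hr).deriv.deriv_eq, (heq r hr).deriv_eq] at this
  have hpos := aux_pos (deriv h) (n + m - 1) (m - 1) (by linarith) (by linarith)
    hsm1.continuous hd1 (fun r hr => (hineq' r hr).1)
  obtain ⟨p, hp⟩ : ∃ p : ℕ, 2 * m + n = p + 4 := ⟨2 * m + n - 4, by omega⟩
  have hpR : 2 * (m : ℝ) + n = p + 4 := by exact_mod_cast hp
  have hc : (0 : ℝ) < m + n - 2 := by linarith
  have hbd := aux_bound (deriv h) p (by omega) (m + n - 2) hc hd1 hpos (fun r hr => by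
    have := (hineq' r hr).2
    rwa [show 2 * (m : ℝ) + n - 3 = p + 1 by linarith] at this)
  have hk : (p : ℝ) / (m + n - 2) ≤ m / 2 := by
    rw [div_le_div_iff₀ hc (by norm_num)]
    have : (0 : ℝ) ≤ (m - 2) * (m - 4 + n) := by
      rcases hm.eq_or_lt with h2 | h2
      · rw [← h2]; norm_num
      · have : (3 : ℝ) ≤ m := by exact_mod_cast h2
        exact mul_nonneg (by linarith) (by linarith)
    have hp' : (p : ℝ) = 2 * m + n - 4 := by linarith
    rw [hp']
    nlinarith
  have hbd' : ∀ r : ℝ, 0 < r → deriv h r ≤ m / 2 / r := fun r hr =>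
    (hbd r hr).trans (by gcongr)
  have hanti : AntitoneOn (fun r => h r - m / 2 * Real.log r) (Set.Ici 1) := by
    have hD : ∀ r : ℝ, 0 < r → HasDerivAt (fun r => h r - m / 2 * Real.log r)
        (deriv h r - m / 2 * r⁻¹) r := fun r hr =>
      (hd0 r).hasDerivAt.sub ((Real.hasDerivAt_log hr.ne').const_mul _)
    apply antitoneOn_of_deriv_nonpos (convex_Ici 1)
    · intro r hr
      exact (hD r (zero_lt_one.trans_le hr)).continuousAt.continuousWithinAt
    · intro r hr
      rw [interior_Ici] at hr
      exact (hD r (zero_lt_one.trans hr)).differentiableAt.differentiableWithinAt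
    · intro r hr
      rw [interior_Ici] at hr
      have hr0 : 0 < r := zero_lt_one.trans hr
      rw [(hD r hr0).deriv]
      have := hbd' r hr0
      rw [div_eq_mul_inv _ r] at this
      linarith
  have hlow : ∀ r : ℝ, 1 < r →
      Real.exp (-2 * h 1) * r⁻¹ ≤ r ^ (m - 1) * Real.exp (-2 * f r) := by
    intro r hr
    have hr0 : 0 < r := zero_lt_one.trans hr
    have h1 := hanti (Set.mem_Ici.2 le_rfl) (Set.mem_Ici.2 hr.le) hr.le
    have h2 : f r = h r := by simp [hh, abs_of_pos hr0]
    simp only [Real.log_one, mul_zero, sub_zero] at h1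
    have h3 : Real.exp (-2 * h 1 - m * Real.log r) ≤ Real.exp (-2 * f r) := by
      apply Real.exp_le_exp.2
      rw [h2]; linarith
    rw [Real.exp_sub, Real.exp_nat_mul, Real.exp_log hr0] at h3
    refine le_trans (le_of_eq ?_) (mul_le_mul_of_nonneg_left h3 (by positivity))
    obtain ⟨q, rfl⟩ : ∃ q, m = q + 1 := ⟨m - 1, by omega⟩
    rw [Nat.add_sub_cancel]
    field_simp
    ring
  have : Nontrivial (EuclideanSpace ℝ (Fin m)) := ⟨e, 0, by
    intro h0; rw [h0] at hen; simp at hen⟩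
  have hint2 := (integrable_fun_norm_addHaar (μ := (volume : Measure (EuclideanSpace ℝ (Fin m))))
    (f := fun r => Real.exp (-2 * f r))).1 hint
  rw [finrank_euclideanSpace_fin] at hint2
  have hint3 := hint2.mono_set (Set.Ioi_subset_Ioi (zero_le_one (α := ℝ)))
  have hint4 : IntegrableOn (fun r : ℝ => Real.exp (-2 * h 1) * r⁻¹) (Set.Ioi 1) := by
    refine Integrable.mono' hint3 (by fun_prop) ?_
    filter_upwards [ae_restrict_mem measurableSet_Ioi] with r hr
    have hr1 : 1 < r := hr
    have hr0 : 0 < r := zero_lt_one.trans hr1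
    rw [Real.norm_of_nonneg (by positivity)]
    simpa using hlow r hr1
  refine not_integrableOn_Ioi_inv (a := (1 : ℝ)) ?_
  have := hint4.const_mul (Real.exp (-2 * h 1))⁻¹
  refine this.congr (Filter.Eventually.of_forall fun r => ?_)
  simp only
  rw [← mul_assoc, inv_mul_cancel₀ (Real.exp_pos _).ne', one_mul]
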